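/- (Corollary 1, expectation.) Let (Ω, F, P) be a probability space with a filtration (F_m)_{m=0,…,M}, let h > 0, a > 1, θ₀ ≥ 0 and M ≥ 1. Let A₁, …, A_M be identically distributed integrable real random variables with A_m > 1 almost surely and with A_{m+1} independent of F_m for each 0 ≤ m ≤ M−1; set B_m = (A_m − 1)/(a − 1). Let Θ₀ = θ₀ (constant) and let Θ₁, …, Θ_M be integrable random variables with Θ_m F_m-measurable, such that for each 0 ≤ m ≤ M−1, letting G_m = F_m ∨ σ(A_{m+1}), E[Θ_{m+1} | G_m] = e^{-h} Θ_m + (1 − e^{-h}) A_{m+1}/B_{m+1} almost surely, and A_{m+1}/B_{m+1} is integrable. Then E[Θ_M] = θ₀ e^{-Mh} + (1 − e^{-Mh}) (a − 1) E[A₁/(A₁ − 1)]. -/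

import Mathlib

open MeasureTheory ProbabilityTheory Real

/-- A function has the same integral as its conditional expectation, provided the latter is
almost everywhere equal to a function with nonzero integral: this rules out the junk value `0`
that `condExp` takes when the conditioning `m` is not a sub-σ-algebra. -/
theorem integral_eq_of_condExp_ae_eq_of_integral_ne_zero {Ω : Type*} {m m0 : MeasurableSpace Ω}
    {P : Measure Ω} [IsFiniteMeasure P] {f g : Ω → ℝ} (hfg : P[f | m] =ᵐ[P] g)
    (hg : ∫ ω, g ω ∂P ≠ 0) : ∫ ω, f ω ∂P = ∫ ω, g ω ∂P := by
  have hint := integral_congr_ae hfg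
  by_cases hm : m ≤ m0
  · rw [← hint, integral_condExp hm]
  · rw [condExp_of_not_le hm] at hint
    simp only [Pi.zero_apply, integral_zero] at hint
    exact absurd hint.symm hg

/-- Corollary 1 (expectation) for the control variate-based stochastic
Cox–Ingersoll–Ross process. -/
theorem scirCV_expectation {Ω : Type*} [m0 : MeasurableSpace Ω] (P : Measure Ω)
    [IsProbabilityMeasure P] (F : Filtration ℕ m0)
    (M : ℕ) (hM : 1 ≤ M) (h a θ₀ : ℝ) (hh : 0 < h) (ha : 1 < a) (hθ : 0 ≤ θ₀)
    (A : ℕ → Ω → ℝ)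
    -- the A_m are identically distributed
    (hA_ident : ∀ m, 1 ≤ m → m ≤ M → Measure.map (A m) P = Measure.map (A 1) P)
    -- each A_m is integrable
    (hA_int : ∀ m, 1 ≤ m → m ≤ M → Integrable (A m) P)
    -- A_m > 1 almost surely
    (hA_gt : ∀ m, 1 ≤ m → m ≤ M → ∀ᵐ ω ∂P, 1 < A m ω)
    -- A_{m+1} is independent of F_m
    (hA_indep : ∀ m, m ≤ M - 1 →
      Indep (MeasurableSpace.comap (A (m + 1)) Real.measurableSpace) (F m) P)
    (Θ : ℕ → Ω → ℝ)
    (hΘ0 : Θ 0 = fun _ => θ₀)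
    (hΘ_int : ∀ m, m ≤ M → Integrable (Θ m) P)
    (hΘ_meas : ∀ m, m ≤ M → Measurable[F m] (Θ m))
    -- A_{m+1}/B_{m+1} is integrable, where B_m = (A_m - 1)/(a - 1)
    (hAB_int : ∀ m, m ≤ M - 1 →
      Integrable (fun ω => A (m + 1) ω / ((A (m + 1) ω - 1) / (a - 1))) P)
    -- the one-step conditional mean, with G_m = F_m ⊔ σ(A_{m+1})
    (hcond : ∀ m, m ≤ M - 1 →
      P[Θ (m + 1) | F m ⊔ MeasurableSpace.comap (A (m + 1)) Real.measurableSpace]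
        =ᵐ[P] fun ω => Real.exp (-h) * Θ m ω +
          (1 - Real.exp (-h)) * (A (m + 1) ω / ((A (m + 1) ω - 1) / (a - 1)))) :
    ∫ ω, Θ M ω ∂P =
      θ₀ * Real.exp (-(M : ℝ) * h) +
        (1 - Real.exp (-(M : ℝ) * h)) * (a - 1) * ∫ ω, A 1 ω / (A 1 ω - 1) ∂P := by
  have hdiv (x : ℝ) : x / ((x - 1) / (a - 1)) = (a - 1) * (x / (x - 1)) := by
    rw [div_div_eq_mul_div]; ring
  simp only [hdiv] at hAB_int hcond
  have ha' : 0 < a - 1 := sub_pos.2 ha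
  set c : ℝ := ∫ ω, A 1 ω / (A 1 ω - 1) ∂P with hc
  have hc_pos : 0 < c := by
    have hint : Integrable (fun ω => A 1 ω / (A 1 ω - 1)) P :=
      (integrable_const_mul_iff (IsUnit.mk0 _ ha'.ne') _).1 (hAB_int 0 (Nat.zero_le _))
    have hle : ∫ _, (1 : ℝ) ∂P ≤ c := by
      refine integral_mono_ae (integrable_const 1) hint ?_
      filter_upwards [hA_gt 1 le_rfl hM] with ω hω
      exact (one_le_div (sub_pos.2 hω)).2 (by linarith)
    simp only [integral_const, probReal_univ, smul_eq_mul, mul_one] at hle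
    linarith
  have hmean (m : ℕ) (hm1 : 1 ≤ m) (hmM : m ≤ M) :
      ∫ ω, A m ω / (A m ω - 1) ∂P = c := by
    have hmeas : Measurable fun x : ℝ => x / (x - 1) := by fun_prop
    rw [hc, ← integral_map (hA_int m hm1 hmM).aemeasurable hmeas.aestronglyMeasurable,
      hA_ident m hm1 hmM,
      integral_map (hA_int 1 le_rfl hM).aemeasurable hmeas.aestronglyMeasurable]
  have hexp_lt : Real.exp (-h) < 1 := Real.exp_lt_one_iff.2 (neg_neg_of_pos hh)
  have key : ∀ m, m ≤ M → ∫ ω, Θ m ω ∂P =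
      θ₀ * Real.exp (-(m : ℝ) * h) + (1 - Real.exp (-(m : ℝ) * h)) * (a - 1) * c := by
    intro m
    induction m with
    | zero => intro _; simp [hΘ0]
    | succ m ih =>
      intro hm
      have hm' : m ≤ M - 1 := by omega
      have ih := ih (by omega)
      have hnonneg : 0 ≤ ∫ ω, Θ m ω ∂P := by
        have h1 : Real.exp (-(m : ℝ) * h) ≤ 1 := Real.exp_le_one_iff.2 (by
          rw [neg_mul]; exact neg_nonpos.2 (by positivity))
        have h2 := sub_nonneg.2 h1
        rw [ih]
        positivity
      have hstep : ∫ ω, (Real.exp (-h) * Θ m ω +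
          (1 - Real.exp (-h)) * ((a - 1) * (A (m + 1) ω / (A (m + 1) ω - 1)))) ∂P =
          Real.exp (-h) * ∫ ω, Θ m ω ∂P + (1 - Real.exp (-h)) * ((a - 1) * c) := by
        rw [integral_add ((hΘ_int m (by omega)).const_mul _) ((hAB_int m hm').const_mul _),
          integral_const_mul, integral_const_mul, integral_const_mul,
          hmean (m + 1) (by omega) hm]
      have hpos : 0 < Real.exp (-h) * ∫ ω, Θ m ω ∂P +
          (1 - Real.exp (-h)) * ((a - 1) * c) := by
        have h2 := sub_pos.2 hexp_lt
        positivity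
      rw [integral_eq_of_condExp_ae_eq_of_integral_ne_zero (hcond m hm')
        (by rw [hstep]; exact hpos.ne'), hstep, ih]
      have hexp : Real.exp (-((m + 1 : ℕ) : ℝ) * h) =
          Real.exp (-h) * Real.exp (-(m : ℝ) * h) := by
        rw [← Real.exp_add]; push_cast; ring_nf
      rw [hexp]
      ring
  exact key M le_rfl
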